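/- Let ρ > 1, Q > 0, ε ≥ 0, and let integers M ≤ N be given with N ≥ 1. Let f be given on [-1, (ρ+ρ⁻¹)/2) by a Chebyshev series f(x) = Σ_{n≥0} a_n T_n(x) with |a_0| ≤ Q and |a_n| ≤ 2Q ρ^{-n} for n ≥ 1. Let ε_vec ∈ ℝ^{N+1} satisfy ‖ε_vec‖_∞ ≤ ε, let c ∈ ℝ^{M+1} solve the normal equations T_M(x^{equi})ᵀ T_M(x^{equi}) c = T_M(x^{equi})ᵀ (f(x^{equi}) + ε_vec), and set p_M(x) = Σ_{k=0}^M c_k T_k(x). Then for every x with 1 ≤ x < (ρ+ρ⁻¹)/2, writing r = (x + √(x²−1))/ρ, |f(x) − p_M(x)| ≤ 2Q [ (N+1)^{1/2}(M+1) / (σ_{M+1}(T_M(x^{equi}))(ρ−1)) + r/(1−r) ] r^M + ((M+1)(N+1)^{1/2} ε / σ_{M+1}(T_M(x^{equi}))) (ρ r)^M. -/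

import Mathlib

open Matrix MeasureTheory
open scoped BigOperators

/-- Chebyshev polynomial of the first kind `T_n`, as a function `ℝ → ℝ`. -/
noncomputable def cheb (n : ℕ) (x : ℝ) : ℝ :=
  (Polynomial.Chebyshev.T ℝ (n : ℤ)).eval x

/-- The equally spaced grid `x_k = 2k/N - 1`, `k = 0, …, N`, on `[-1,1]`. -/
noncomputable def xequi (N : ℕ) (k : Fin (N + 1)) : ℝ :=
  2 * (k : ℝ) / (N : ℝ) - 1

/-- The `(N+1) × (M+1)` Chebyshev–Vandermonde matrix at the equally spaced grid. -/
noncomputable def chebVand (N M : ℕ) : Matrix (Fin (N + 1)) (Fin (M + 1)) ℝ :=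
  Matrix.of fun i j => cheb (j : ℕ) (xequi N i)

/-- The Euclidean norm of a vector in `ℝ^n`. -/
noncomputable def enorm2 {n : ℕ} (v : Fin n → ℝ) : ℝ :=
  Real.sqrt (∑ i, (v i) ^ 2)

/-- The smallest singular value of a matrix, as the infimum of `‖A v‖₂` over unit vectors. -/
noncomputable def sigmaMin {m n : ℕ} (A : Matrix (Fin m) (Fin n) ℝ) : ℝ :=
  sInf {r | ∃ v : Fin n → ℝ, enorm2 v = 1 ∧ r = enorm2 (A.mulVec v)}

/-- The largest singular value of a matrix, as the supremum of `‖A v‖₂` over unit vectors. -/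
noncomputable def sigmaMax {m n : ℕ} (A : Matrix (Fin m) (Fin n) ℝ) : ℝ :=
  sSup {r | ∃ v : Fin n → ℝ, enorm2 v = 1 ∧ r = enorm2 (A.mulVec v)}

theorem enorm2_eq_norm {n : ℕ} (v : Fin n → ℝ) : enorm2 v = ‖WithLp.toLp 2 v‖ := by
  simp [enorm2, EuclideanSpace.norm_eq]

theorem enorm2_nonneg {n : ℕ} (v : Fin n → ℝ) : 0 ≤ enorm2 v :=
  Real.sqrt_nonneg _

theorem sq_enorm2 {n : ℕ} (v : Fin n → ℝ) : enorm2 v ^ 2 = v ⬝ᵥ v := by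
  rw [enorm2, Real.sq_sqrt (Finset.sum_nonneg fun i _ => sq_nonneg _)]
  simp [dotProduct, sq]

theorem enorm2_smul {n : ℕ} (t : ℝ) (v : Fin n → ℝ) : enorm2 (t • v) = |t| * enorm2 v := by
  simp only [enorm2_eq_norm, WithLp.toLp_smul, norm_smul, Real.norm_eq_abs]

theorem enorm2_pos {n : ℕ} {v : Fin n → ℝ} (hv : v ≠ 0) : 0 < enorm2 v := by
  rw [enorm2_eq_norm, norm_pos_iff]
  simpa using hv

theorem dotProduct_le_enorm2_mul_enorm2 {n : ℕ} (v w : Fin n → ℝ) :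
    v ⬝ᵥ w ≤ enorm2 v * enorm2 w :=
  Real.sum_mul_le_sqrt_mul_sqrt _ _ _

theorem abs_apply_le_enorm2 {n : ℕ} (v : Fin n → ℝ) (i : Fin n) : |v i| ≤ enorm2 v := by
  rw [enorm2_eq_norm]
  exact PiLp.norm_apply_le (WithLp.toLp 2 v) i

theorem enorm2_le_sqrt_mul {n : ℕ} {v : Fin n → ℝ} {B : ℝ} (hB : 0 ≤ B)
    (hv : ∀ i, |v i| ≤ B) : enorm2 v ≤ Real.sqrt n * B := by
  rw [enorm2, ← Real.sqrt_sq hB, ← Real.sqrt_mul n.cast_nonneg]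
  refine Real.sqrt_le_sqrt ((Finset.sum_le_sum fun i _ => sq_le_sq' (neg_le_of_abs_le (hv i))
    (le_of_abs_le (hv i))).trans ?_)
  simp

theorem sigmaMin_mul_enorm2_le {m n : ℕ} (A : Matrix (Fin m) (Fin n) ℝ) (v : Fin n → ℝ) :
    sigmaMin A * enorm2 v ≤ enorm2 (A *ᵥ v) := by
  rcases eq_or_ne v 0 with rfl | hv
  · simp [enorm2]
  have hpos := enorm2_pos hv
  have hle : sigmaMin A ≤ enorm2 (A *ᵥ ((enorm2 v)⁻¹ • v)) := by
    refine csInf_le ⟨0, ?_⟩ ⟨(enorm2 v)⁻¹ • v, ?_, rfl⟩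
    · rintro _ ⟨w, -, rfl⟩
      exact enorm2_nonneg _
    · rw [enorm2_smul, abs_of_pos (inv_pos.2 hpos), inv_mul_cancel₀ hpos.ne']
  rwa [mulVec_smul, enorm2_smul, abs_of_pos (inv_pos.2 hpos), inv_mul_eq_div,
    le_div_iff₀ hpos] at hle

theorem sigmaMin_pos {m n : ℕ} [NeZero n] {A : Matrix (Fin m) (Fin n) ℝ}
    (hA : ∀ v, A *ᵥ v = 0 → v = 0) : 0 < sigmaMin A := by
  have hcont : Continuous fun v : EuclideanSpace ℝ (Fin n) => enorm2 (A *ᵥ v.ofLp) := by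
    unfold enorm2 mulVec dotProduct
    fun_prop
  obtain ⟨u, hu, hmin⟩ := (isCompact_sphere (0 : EuclideanSpace ℝ (Fin n)) 1).exists_isMinOn
    (NormedSpace.sphere_nonempty.2 zero_le_one) hcont.continuousOn
  have hu1 : enorm2 u.ofLp = 1 := by simpa [enorm2_eq_norm] using hu
  have hne : A *ᵥ u.ofLp ≠ 0 := fun h => by
    simp [hA _ h, enorm2] at hu1
  refine (enorm2_pos hne).trans_le (le_csInf ⟨_, u.ofLp, hu1, rfl⟩ ?_)
  rintro _ ⟨v, hv, rfl⟩
  exact hmin (show WithLp.toLp 2 v ∈ _ by simpa [enorm2_eq_norm] using hv)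

theorem enorm2_le_div_sigmaMin_of_normal_equations {m n : ℕ} {A : Matrix (Fin m) (Fin n) ℝ}
    (hA : 0 < sigmaMin A) {d : Fin n → ℝ} {w : Fin m → ℝ} (h : (Aᵀ * A) *ᵥ d = Aᵀ *ᵥ w) :
    enorm2 d ≤ enorm2 w / sigmaMin A := by
  have hsq : enorm2 (A *ᵥ d) ^ 2 ≤ enorm2 (A *ᵥ d) * enorm2 w := by
    refine le_trans (le_of_eq ?_) (dotProduct_le_enorm2_mul_enorm2 (A *ᵥ d) w)
    rw [sq_enorm2, dotProduct_mulVec, ← mulVec_transpose, mulVec_mulVec, h, dotProduct_comm,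
      dotProduct_mulVec, vecMul_transpose]
  have hle : enorm2 (A *ᵥ d) ≤ enorm2 w := by
    by_contra! hlt
    nlinarith [enorm2_nonneg w]
  rw [le_div_iff₀' hA]
  exact (sigmaMin_mul_enorm2_le A d).trans hle

theorem xequi_mem_Icc {N : ℕ} (hN : 1 ≤ N) (i : Fin (N + 1)) :
    xequi N i ∈ Set.Icc (-1 : ℝ) 1 := by
  have hN' : (0 : ℝ) < N := by exact_mod_cast hN
  have hi : (i : ℝ) ≤ N := by exact_mod_cast Nat.lt_succ_iff.1 i.2
  have h1 : 2 * (i : ℝ) / N ≤ 2 := by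
    rw [div_le_iff₀ hN']; linarith
  have h0 : 0 ≤ 2 * (i : ℝ) / N := by positivity
  constructor <;> unfold xequi <;> linarith

theorem xequi_injective {N : ℕ} (hN : 1 ≤ N) : Function.Injective (xequi N) := by
  intro i j hij
  have hN' : (N : ℝ) ≠ 0 := by positivity
  unfold xequi at hij
  field_simp at hij
  exact Fin.ext (by exact_mod_cast (by linarith : (i : ℝ) = j))

/-- The Chebyshev polynomials of the first kind, as a sequence with one polynomial per degree. -/
noncomputable def chebSequence : Polynomial.Sequence ℝ where
  elems' n := Polynomial.Chebyshev.T ℝ n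
  degree_eq' n := by simp [Polynomial.Chebyshev.degree_T]

theorem chebVand_mulVec_eq_zero {N M : ℕ} (hMN : M ≤ N) (hN : 1 ≤ N) (v : Fin (M + 1) → ℝ)
    (hv : chebVand N M *ᵥ v = 0) : v = 0 := by
  set p : Polynomial ℝ := ∑ j : Fin (M + 1), v j • chebSequence j with hp
  have hdeg : p.natDegree ≤ M := Polynomial.natDegree_sum_le_of_forall_le _ _ fun j _ =>
    (Polynomial.natDegree_smul_le _ _).trans
      (by rw [chebSequence.natDegree_eq]; exact Nat.lt_succ_iff.1 j.2)
  have heval : ∀ i, p.eval (xequi N i) = 0 := fun i => by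
    have := congrFun hv i
    simp only [mulVec, dotProduct, chebVand, of_apply, cheb, Pi.zero_apply] at this
    rw [hp, Polynomial.eval_finsetSum, ← this]
    refine Finset.sum_congr rfl fun j _ => ?_
    rw [Polynomial.eval_smul, smul_eq_mul, mul_comm]
    rfl
  have hp0 : p = 0 := Polynomial.eq_zero_of_natDegree_lt_card_of_eval_eq_zero p
    (xequi_injective hN) heval (by simp; omega)
  have hli := chebSequence.linearIndependent.comp (fun j : Fin (M + 1) => (j : ℕ))
    Fin.val_injective
  funext j
  exact Fintype.linearIndependent_iff.1 hli v hp0 j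

theorem abs_cheb_le_one (n : ℕ) {x : ℝ} (hx : x ∈ Set.Icc (-1 : ℝ) 1) : |cheb n x| ≤ 1 :=
  Polynomial.Chebyshev.abs_eval_T_real_le_one n (abs_le.2 hx)

theorem abs_cheb_le_pow (n : ℕ) {x : ℝ} (hx : 1 ≤ x) :
    |cheb n x| ≤ (x + Real.sqrt (x ^ 2 - 1)) ^ n := by
  have h0 : 0 ≤ Real.arcosh x := Real.arcosh_nonneg hx
  have hn : 0 ≤ (n : ℝ) * Real.arcosh x := mul_nonneg n.cast_nonneg h0
  have hT : cheb n x = Real.cosh (n * Real.arcosh x) := by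
    have := Polynomial.Chebyshev.T_real_cosh (Real.arcosh x) n
    rwa [Real.cosh_arcosh hx, Int.cast_natCast] at this
  rw [hT, abs_of_pos (Real.cosh_pos _), ← Real.exp_arcosh hx, ← Real.exp_nat_mul, Real.cosh_eq]
  have := Real.exp_le_exp.2 (by linarith : -(n * Real.arcosh x) ≤ n * Real.arcosh x)
  linarith

theorem add_sqrt_sq_sub_one_lt {ρ x : ℝ} (hρ : 1 < ρ) (hx : x < (ρ + ρ⁻¹) / 2) :
    x + Real.sqrt (x ^ 2 - 1) < ρ := by
  have hinv : ρ⁻¹ < 1 := inv_lt_one_of_one_lt₀ hρ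
  have hmul : ρ * ρ⁻¹ = 1 := mul_inv_cancel₀ (by positivity)
  have hsqrt : Real.sqrt (x ^ 2 - 1) < ρ - x := by
    rw [Real.sqrt_lt' (by linarith)]
    nlinarith
  linarith

theorem abs_sub_partial_sum_cheb_le {ρ Q x y s : ℝ} {a : ℕ → ℝ} (hρ : 0 < ρ) (hy : 0 ≤ y)
    (hyρ : y < ρ) (ha : ∀ n : ℕ, 1 ≤ n → |a n| ≤ 2 * Q * ρ ^ (-(n : ℤ)))
    (hT : ∀ n, |cheb n x| ≤ y ^ n) (hs : HasSum (fun n => a n * cheb n x) s) (M : ℕ) :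
    |s - ∑ k : Fin (M + 1), a k * cheb k x| ≤ 2 * Q * ((y / ρ) / (1 - y / ρ)) * (y / ρ) ^ M := by
  have htail : HasSum (fun n => a (n + (M + 1)) * cheb (n + (M + 1)) x)
      (s - ∑ k : Fin (M + 1), a k * cheb k x) := by
    rw [Fin.sum_univ_eq_sum_range (fun k => a k * cheb k x)]
    exact (hasSum_nat_add_iff' (M + 1)).2 hs
  have hgeom := (hasSum_geometric_of_lt_one (div_nonneg hy hρ.le)
    ((div_lt_one hρ).2 hyρ)).mul_left (2 * Q * (y / ρ) ^ (M + 1))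
  refine (htail.norm_le_of_bounded hgeom fun n => ?_).trans (le_of_eq (by ring))
  rw [Real.norm_eq_abs, abs_mul]
  calc |a (n + (M + 1))| * |cheb (n + (M + 1)) x|
      ≤ 2 * Q * ρ ^ (-((n + (M + 1) : ℕ) : ℤ)) * y ^ (n + (M + 1)) :=
        mul_le_mul (ha _ (by omega)) (hT _) (abs_nonneg _) ((abs_nonneg _).trans (ha _ (by omega)))
    _ = 2 * Q * (y / ρ) ^ (M + 1) * (y / ρ) ^ n := by
        rw [_root_.zpow_neg, _root_.zpow_natCast, div_pow, div_pow, pow_add, pow_add]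
        field_simp
        ring

theorem abs_sum_mul_cheb_le {M : ℕ} {y x : ℝ} (hy : 1 ≤ y) (hT : ∀ n, |cheb n x| ≤ y ^ n)
    (d : Fin (M + 1) → ℝ) :
    |∑ k : Fin (M + 1), d k * cheb k x| ≤ (M + 1) * enorm2 d * y ^ M := by
  have hterm : ∀ k ∈ Finset.univ, |d k * cheb k x| ≤ enorm2 d * y ^ M := fun k _ => by
    rw [abs_mul]
    exact mul_le_mul (abs_apply_le_enorm2 d k)
      ((hT k).trans (pow_le_pow_right₀ hy (Nat.lt_succ_iff.1 k.2))) (abs_nonneg _)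
      (enorm2_nonneg d)
  refine (Finset.abs_sum_le_sum_abs _ _).trans ((Finset.sum_le_card_nsmul _ _ _ hterm).trans ?_)
  simp [mul_assoc]

/-- **Corollary 6.3 of the paper**: extrapolation with deterministic perturbations
of size at most `ε`. For `1 ≤ x < (ρ+ρ⁻¹)/2` and `r = (x+√(x²−1))/ρ`,
`|f(x) − p_M(x)| ≤ 2Q [√(N+1)(M+1)/(σ_{M+1}(ρ−1)) + r/(1−r)] r^M
+ ((M+1)√(N+1) ε / σ_{M+1}) (ρr)^M`. -/
theorem deterministic_extrapolation (ρ Q ε : ℝ) (hρ : 1 < ρ) (hQ : 0 < Q) (hε : 0 ≤ ε)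
    (M N : ℕ) (hMN : M ≤ N) (hN : 1 ≤ N)
    (f : ℝ → ℝ) (a : ℕ → ℝ)
    (hf : ∀ x ∈ Set.Ico (-1 : ℝ) ((ρ + ρ⁻¹) / 2),
      HasSum (fun n : ℕ => a n * cheb n x) (f x))
    (ha0 : |a 0| ≤ Q)
    (ha : ∀ n : ℕ, 1 ≤ n → |a n| ≤ 2 * Q * ρ ^ (-(n : ℤ)))
    (εvec : Fin (N + 1) → ℝ) (hεvec : ∀ i, |εvec i| ≤ ε)
    (c : Fin (M + 1) → ℝ)
    (hc : ((chebVand N M).transpose * chebVand N M) *ᵥ c =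
      (chebVand N M).transpose *ᵥ (fun i => f (xequi N i) + εvec i)) :
    ∀ x ∈ Set.Ico (1 : ℝ) ((ρ + ρ⁻¹) / 2),
      |f x - ∑ k : Fin (M + 1), c k * cheb (k : ℕ) x| ≤
        2 * Q * (Real.sqrt ((N : ℝ) + 1) * ((M : ℝ) + 1) /
              (sigmaMin (chebVand N M) * (ρ - 1)) +
            ((x + Real.sqrt (x ^ 2 - 1)) / ρ) / (1 - (x + Real.sqrt (x ^ 2 - 1)) / ρ)) *
          ((x + Real.sqrt (x ^ 2 - 1)) / ρ) ^ M +
        ((M : ℝ) + 1) * Real.sqrt ((N : ℝ) + 1) * ε / sigmaMin (chebVand N M) *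
          (ρ * ((x + Real.sqrt (x ^ 2 - 1)) / ρ)) ^ M := by
  intro x hx
  have hρ0 : 0 < ρ := by linarith
  have hσ : 0 < sigmaMin (chebVand N M) := sigmaMin_pos (chebVand_mulVec_eq_zero hMN hN)
  have hyρ := add_sqrt_sq_sub_one_lt hρ hx.2
  have hT := fun n => abs_cheb_le_pow n hx.1
  have hy1 : 1 ≤ x + Real.sqrt (x ^ 2 - 1) := by linarith [hx.1, Real.sqrt_nonneg (x ^ 2 - 1)]
  set y := x + Real.sqrt (x ^ 2 - 1)
  set σ := sigmaMin (chebVand N M)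
  set b : Fin (M + 1) → ℝ := fun k => a k
  set w : Fin (N + 1) → ℝ := fun i => f (xequi N i) + εvec i - (chebVand N M *ᵥ b) i
  have hgrid : ∀ i, |w i| ≤ 2 * Q / (ρ - 1) * (1 / ρ) ^ M + ε := fun i => by
    have hi := xequi_mem_Icc hN i
    have hmem : xequi N i ∈ Set.Ico (-1 : ℝ) ((ρ + ρ⁻¹) / 2) := by
      refine ⟨hi.1, hi.2.trans_lt ?_⟩
      have hmul : ρ * ρ⁻¹ = 1 := mul_inv_cancel₀ hρ0.ne'
      have hinv : 0 < ρ⁻¹ := by positivity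
      nlinarith [mul_pos (mul_pos (sub_pos.2 hρ) (sub_pos.2 hρ)) hinv]
    have htail := abs_sub_partial_sum_cheb_le (y := 1) hρ0 zero_le_one hρ ha
      (fun n => by simpa using abs_cheb_le_one n hi) (hf _ hmem) M
    have hA : (chebVand N M *ᵥ b) i = ∑ k : Fin (M + 1), a k * cheb k (xequi N i) := by
      simp [mulVec, dotProduct, chebVand, b, mul_comm]
    have hconst : 2 * Q * (1 / ρ / (1 - 1 / ρ)) = 2 * Q / (ρ - 1) := by
      have : ρ - 1 ≠ 0 := by linarith
      field_simp
    rw [hconst] at htail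
    calc |w i| = |(f (xequi N i) - ∑ k : Fin (M + 1), a k * cheb k (xequi N i)) + εvec i| := by
          simp only [w, hA]; congr 1; ring
      _ ≤ _ := (abs_add_le _ _).trans (add_le_add htail (hεvec i))
  have hnormal : ((chebVand N M)ᵀ * chebVand N M) *ᵥ (c - b) = (chebVand N M)ᵀ *ᵥ w := by
    have hw : w = (fun i => f (xequi N i) + εvec i) - chebVand N M *ᵥ b := rfl
    rw [hw, mulVec_sub, mulVec_sub, hc, mulVec_mulVec]
  have hB : 0 ≤ 2 * Q / (ρ - 1) * (1 / ρ) ^ M + ε := (abs_nonneg _).trans (hgrid 0)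
  have hd : enorm2 (c - b) ≤
      Real.sqrt ((N : ℝ) + 1) * (2 * Q / (ρ - 1) * (1 / ρ) ^ M + ε) / σ := by
    refine (enorm2_le_div_sigmaMin_of_normal_equations hσ hnormal).trans ?_
    have := enorm2_le_sqrt_mul hB hgrid
    push_cast at this
    gcongr
  have htail := abs_sub_partial_sum_cheb_le hρ0 (by linarith) hyρ ha hT
    (hf x ⟨by linarith [hx.1], hx.2⟩) M
  have hcoef := abs_sum_mul_cheb_le hy1 hT (c - b)
  have hsplit : f x - ∑ k : Fin (M + 1), c k * cheb k x =
      (f x - ∑ k : Fin (M + 1), a k * cheb k x) -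
        ∑ k : Fin (M + 1), (c - b) k * cheb k x := by
    simp only [Pi.sub_apply, sub_mul, Finset.sum_sub_distrib, b]
    ring
  have hcoef' : |∑ k : Fin (M + 1), (c - b) k * cheb k x| ≤
      (M + 1) * (Real.sqrt ((N : ℝ) + 1) * (2 * Q / (ρ - 1) * (1 / ρ) ^ M + ε) / σ) * y ^ M :=
    hcoef.trans (by gcongr)
  rw [hsplit]
  refine (abs_sub _ _).trans ((add_le_add htail hcoef').trans (le_of_eq ?_))
  have hρ1 : ρ - 1 ≠ 0 := by linarith
  rw [mul_div_cancel₀ _ hρ0.ne', div_pow, div_pow, one_pow]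
  generalize y / ρ / (1 - y / ρ) = t
  field_simp
  ring
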